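/- Let f : g → h be a morphism of differential graded Lie algebras over a field of characteristic 0 such that H*(f) is injective and h is homotopy abelian. Then g is homotopy abelian, i.e. g is quasi-isomorphic to an abelian DGLA. -/

import Mathlib

/-!
STATEMENT 17 (Lemma 5.1 of the paper):
Let `f : g → h` be a morphism of differential graded Lie algebras over a field of
characteristic 0 such that `H*(f)` is injective and `h` is homotopy abelian.
Then `g` is homotopy abelian, i.e. quasi-isomorphic (via a zigzag of DGLA
quasi-isomorphisms) to an abelian DGLA.
-/

variable (K : Type) [Field K] [CharZero K]

structure DGLAon (L : Type) [AddCommGroup L] [Module K L] where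
  grading : ℤ → Submodule K L
  internal : DirectSum.IsInternal grading
  d : L →ₗ[K] L
  d_deg : ∀ i : ℤ, ∀ x ∈ grading i, d x ∈ grading (i + 1)
  d_sq : d ∘ₗ d = 0
  bracket : L →ₗ[K] L →ₗ[K] L
  bracket_deg : ∀ i j : ℤ, ∀ x ∈ grading i, ∀ y ∈ grading j, bracket x y ∈ grading (i + j)
  antisymm : ∀ i j : ℤ, ∀ x ∈ grading i, ∀ y ∈ grading j,
    bracket x y = -(((i * j).negOnePow : ℤ) • bracket y x)
  jacobi : ∀ i j : ℤ, ∀ x ∈ grading i, ∀ y ∈ grading j, ∀ z : L,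
    bracket x (bracket y z)
      = bracket (bracket x y) z + ((i * j).negOnePow : ℤ) • bracket y (bracket x z)
  leibniz : ∀ i : ℤ, ∀ x ∈ grading i, ∀ y : L,
    d (bracket x y) = bracket (d x) y + (i.negOnePow : ℤ) • bracket x (d y)

structure DGLA where
  L : Type
  [inst1 : AddCommGroup L]
  [inst2 : Module K L]
  str : DGLAon K L

attribute [instance] DGLA.inst1 DGLA.inst2

structure DGLAHom (G H : DGLA K) where
  f : G.L →ₗ[K] H.L
  compat_d : ∀ x, f (G.str.d x) = H.str.d (f x)
  compat_br : ∀ x y, f (G.str.bracket x y) = H.str.bracket (f x) (f y)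
  compat_gr : ∀ i : ℤ, ∀ x ∈ G.str.grading i, f x ∈ H.str.grading i

/-- `φ` induces a bijection on cohomology (stated elementwise). -/
def IsQuasiIso {G H : DGLA K} (φ : DGLAHom K G H) : Prop :=
  (∀ x : G.L, G.str.d x = 0 → (∃ z, φ.f x = H.str.d z) → ∃ w, x = G.str.d w) ∧
  (∀ y : H.L, H.str.d y = 0 → ∃ x z, G.str.d x = 0 ∧ y = φ.f x + H.str.d z)

def ZigZag : DGLA K → DGLA K → Prop :=
  Relation.EqvGen (fun G H => ∃ φ : DGLAHom K G H, IsQuasiIso K φ)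

def HomotopyAbelian (G : DGLA K) : Prop :=
  ∃ H : DGLA K, (∀ x y, H.str.bracket x y = 0) ∧ ZigZag K G H

section Helpers

variable {F : Type} [Field F]

structure IsProj {L : Type} [AddCommGroup L] [Module F L] (A : ℤ → Submodule F L)
    (π : ℤ → L →ₗ[F] L) : Prop where
  mem : ∀ i x, π i x ∈ A i
  same : ∀ i, ∀ x ∈ A i, π i x = x
  ne : ∀ i j, i ≠ j → ∀ x ∈ A j, π i x = 0
  sum : ∀ x, ∃ s : Finset ℤ, x = ∑ i ∈ s, π i x

section Gr

variable {L N : Type} [AddCommGroup L] [Module F L] [AddCommGroup N] [Module F N]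

theorem exists_extend_gr {A : ℤ → Submodule F L} (h : DirectSum.IsInternal A)
    (g : ℤ → L →ₗ[F] N) : ∃ f : L →ₗ[F] N, ∀ i, ∀ x ∈ A i, f x = g i x := by
  classical
  have hbij : Function.Bijective (DirectSum.coeLinearMap A) := h
  let e := LinearEquiv.ofBijective (DirectSum.coeLinearMap A) hbij
  refine ⟨(DirectSum.toModule F ℤ N (fun i => (g i) ∘ₗ (A i).subtype)) ∘ₗ e.symm.toLinearMap, ?_⟩
  intro i x hx
  have : e.symm x = DirectSum.lof F ℤ (fun i => A i) i ⟨x, hx⟩ := by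
    rw [LinearEquiv.symm_apply_eq]
    simp only [e]
    rw [LinearEquiv.ofBijective_apply, DirectSum.coeLinearMap_lof]
  simp [this]

theorem hom_ext_gr {A : ℤ → Submodule F L} (h : DirectSum.IsInternal A)
    {f g : L →ₗ[F] N} (hfg : ∀ i, ∀ x ∈ A i, f x = g x) : f = g := by
  have htop := h.submodule_iSup_eq_top
  ext x
  have hx : x ∈ ⨆ i, A i := by rw [htop]; trivial
  induction hx using Submodule.iSup_induction' with
  | mem i x hx => exact hfg i x hx
  | zero => simp
  | add x y _ _ hx hy => simp [hx, hy]

theorem exists_proj {A : ℤ → Submodule F L} (h : DirectSum.IsInternal A) :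
    ∃ π, IsProj A π := by
  classical
  have := fun i : ℤ => exists_extend_gr h (N := L)
    (fun j => if i = j then LinearMap.id else 0)
  choose π hπ using this
  have same : ∀ i, ∀ x ∈ A i, π i x = x := by
    intro i x hx; rw [hπ i i x hx]; simp
  have ne : ∀ i j, i ≠ j → ∀ x ∈ A j, π i x = 0 := by
    intro i j hij x hx; rw [hπ i j x hx]; simp [hij]
  have htop := h.submodule_iSup_eq_top
  refine ⟨π, ?_, same, ne, ?_⟩
  · intro i x
    have hx : x ∈ ⨆ i, A i := by rw [htop]; trivial
    induction hx using Submodule.iSup_induction' with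
    | mem j x hx =>
      by_cases hij : i = j
      · subst hij; rw [same i x hx]; exact hx
      · rw [ne i j hij x hx]; exact zero_mem _
    | zero => simp
    | add x y _ _ hx hy => rw [map_add]; exact add_mem hx hy
  · intro x
    have hx : x ∈ ⨆ i, A i := by rw [htop]; trivial
    have key : ∃ s : Finset ℤ, (∀ i, i ∉ s → π i x = 0) ∧ x = ∑ i ∈ s, π i x := by
      induction hx using Submodule.iSup_induction' with
      | mem j x hx =>
        refine ⟨{j}, fun i hi => ne i j (by simpa using hi) x hx, ?_⟩
        simp [same j x hx]
      | zero => exact ⟨∅, by simp, by simp⟩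
      | add x y _ _ hx hy =>
        obtain ⟨s, hs, hs'⟩ := hx
        obtain ⟨t, ht, ht'⟩ := hy
        refine ⟨s ∪ t, fun i hi => ?_, ?_⟩
        · simp only [Finset.mem_union, not_or] at hi
          rw [map_add, hs i hi.1, ht i hi.2, add_zero]
        · have e1 : ∑ i ∈ s ∪ t, π i x = ∑ i ∈ s, π i x :=
            (Finset.sum_subset Finset.subset_union_left (fun i _ hi => hs i hi)).symm
          have e2 : ∑ i ∈ s ∪ t, π i y = ∑ i ∈ t, π i y :=
            (Finset.sum_subset Finset.subset_union_right (fun i _ hi => ht i hi)).symm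
          simp only [map_add, Finset.sum_add_distrib]
          rw [e1, e2, ← hs', ← ht']
    obtain ⟨s, _, hs⟩ := key
    exact ⟨s, hs⟩

theorem internal_of_proj {A : ℤ → Submodule F L} (π : ℤ → L →ₗ[F] L)
    (same : ∀ i, ∀ x ∈ A i, π i x = x)
    (ne : ∀ i j, i ≠ j → ∀ x ∈ A j, π i x = 0)
    (top : ∀ x, x ∈ ⨆ i, A i) : DirectSum.IsInternal A := by
  rw [DirectSum.isInternal_submodule_iff_iSupIndep_and_iSup_eq_top]
  refine ⟨?_, eq_top_iff.2 fun x _ => top x⟩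
  intro i
  rw [Submodule.disjoint_def]
  intro x hx hx'
  have : (⨆ j, ⨆ (_ : j ≠ i), A j) ≤ LinearMap.ker (π i) := by
    refine iSup_le fun j => iSup_le fun hj => ?_
    intro y hy
    exact ne i j (Ne.symm hj) y hy
  rw [← same i x hx]
  exact this hx'

theorem IsProj.ext {A : ℤ → Submodule F L} {π} (h : IsProj A π) {x y : L}
    (hxy : ∀ i, π i x = π i y) : x = y := by
  obtain ⟨s, hs⟩ := h.sum (x - y)
  rw [← sub_eq_zero, hs]
  apply Finset.sum_eq_zero
  intro i _
  rw [map_sub, hxy, sub_self]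

theorem IsProj.comm {A : ℤ → Submodule F L} {π} (hA : DirectSum.IsInternal A) (h : IsProj A π)
    {B : ℤ → Submodule F N} {ρ} (h' : IsProj B ρ) (f : L →ₗ[F] N) (k : ℤ)
    (hf : ∀ i, ∀ x ∈ A i, f x ∈ B (i + k)) (i : ℤ) (x : L) :
    f (π i x) = ρ (i + k) (f x) := by
  have : f ∘ₗ π i = ρ (i + k) ∘ₗ f := by
    apply hom_ext_gr hA
    intro j x hx
    by_cases hij : i = j
    · subst hij
      simp [h.same i x hx, h'.same (i + k) _ (hf i x hx)]
    · simp [h.ne i j hij x hx, h'.ne (i + k) (j + k) (by simpa using hij) _ (hf j x hx)]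
  exact LinearMap.congr_fun this x

/-- graded subspaces have graded projections -/
theorem exists_graded_projection {A : ℤ → Submodule F L} (hA : DirectSum.IsInternal A) {π}
    (h : IsProj A π) (S : Submodule F L) (hS : ∀ i, ∀ x ∈ S, π i x ∈ S) :
    ∃ p : L →ₗ[F] L, (∀ x, p x ∈ S) ∧ (∀ x ∈ S, p x = x) ∧ (∀ i, ∀ x ∈ A i, p x ∈ A i) := by
  have : ∀ i, ∃ q : L →ₗ[F] L, (∀ x, q x ∈ S ⊓ A i) ∧ ∀ x ∈ S ⊓ A i, q x = x := by
    intro i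
    obtain ⟨g, hg⟩ := LinearMap.exists_leftInverse_of_injective (S ⊓ A i).subtype
      (Submodule.ker_subtype _)
    refine ⟨(S ⊓ A i).subtype ∘ₗ g, fun x => (g x).2, fun x hx => ?_⟩
    have := LinearMap.congr_fun hg ⟨x, hx⟩
    exact congrArg Subtype.val this
  choose q hq hq' using this
  obtain ⟨p, hp⟩ := exists_extend_gr hA q
  have hgr : ∀ i, ∀ x ∈ A i, p x ∈ A i := fun i x hx => by rw [hp i x hx]; exact (hq i x).2
  refine ⟨p, ?_, ?_, hgr⟩
  · intro x
    obtain ⟨s, hs⟩ := h.sum x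
    rw [hs, map_sum]
    refine sum_mem fun i _ => ?_
    rw [hp i _ (h.mem i x)]
    exact (hq i _).1
  · intro x hx
    obtain ⟨s, hs⟩ := h.sum x
    conv_lhs => rw [hs]
    conv_rhs => rw [hs]
    rw [map_sum]
    refine Finset.sum_congr rfl fun i _ => ?_
    rw [hp i _ (h.mem i x)]
    exact hq' i _ ⟨hS i x hx, h.mem i x⟩

end Gr

/-- sub-DGLA on a graded subspace stable under `d` and the bracket -/
def subDGLA (A : DGLA F) (S : Submodule F A.L) (hd : ∀ x ∈ S, A.str.d x ∈ S)
    (hb : ∀ x ∈ S, ∀ y ∈ S, A.str.bracket x y ∈ S)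
    (hg : ∀ π, IsProj A.str.grading π → ∀ i, ∀ x ∈ S, π i x ∈ S) : DGLA F where
  L := S
  str :=
    { grading := fun i => (A.str.grading i).comap S.subtype
      internal := by
        obtain ⟨π, hπ⟩ := exists_proj A.str.internal
        have hg' := hg π hπ
        refine internal_of_proj (fun i => (π i).restrict (hg' i)) ?_ ?_ ?_
        · intro i x hx
          exact Subtype.ext (hπ.same i x hx)
        · intro i j hij x hx
          exact Subtype.ext (hπ.ne i j hij x hx)
        · intro x
          obtain ⟨s, hs⟩ := hπ.sum x
          have : x = ∑ i ∈ s, (⟨π i x, hg' i x x.2⟩ : S) := by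
            apply Subtype.ext
            rw [AddSubmonoidClass.coe_finsetSum]
            exact hs
          rw [this]
          refine sum_mem fun i _ => ?_
          exact Submodule.mem_iSup_of_mem i (hπ.mem i x)
      d := A.str.d.restrict hd
      d_deg := fun i x hx => A.str.d_deg i x hx
      d_sq := by
        ext x
        exact LinearMap.congr_fun A.str.d_sq x
      bracket := LinearMap.mk₂ F (fun x y : S => (⟨A.str.bracket x y, hb x x.2 y y.2⟩ : S))
        (by intros; ext; simp) (by intros; ext; simp) (by intros; ext; simp)
        (by intros; ext; simp)
      bracket_deg := fun i j x hx y hy => A.str.bracket_deg i j x hx y hy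
      antisymm := fun i j x hx y hy => Subtype.ext (by
        simpa using A.str.antisymm i j x hx y hy)
      jacobi := fun i j x hx y hy z => Subtype.ext (by
        simpa using A.str.jacobi i j x hx y hy z)
      leibniz := fun i x hx y => Subtype.ext (by
        simpa using A.str.leibniz i x hx y) }

def prodDGLA (A B : DGLA F) : DGLA F where
  L := A.L × B.L
  str :=
    { grading := fun i => (A.str.grading i).prod (B.str.grading i)
      internal := by
        obtain ⟨π, hπ⟩ := exists_proj A.str.internal
        obtain ⟨ρ, hρ⟩ := exists_proj B.str.internal
        refine internal_of_proj (fun i => (π i).prodMap (ρ i)) ?_ ?_ ?_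
        · intro i x hx
          exact Prod.ext (hπ.same i _ hx.1) (hρ.same i _ hx.2)
        · intro i j hij x hx
          exact Prod.ext (hπ.ne i j hij _ hx.1) (hρ.ne i j hij _ hx.2)
        · intro x
          obtain ⟨s, hs⟩ := hπ.sum x.1
          obtain ⟨t, ht⟩ := hρ.sum x.2
          have : x = ∑ i ∈ s, LinearMap.inl F A.L B.L (π i x.1)
              + ∑ i ∈ t, LinearMap.inr F A.L B.L (ρ i x.2) := by
            rw [← map_sum, ← map_sum, ← hs, ← ht]
            simp
          rw [this]
          refine add_mem (sum_mem fun i _ => Submodule.mem_iSup_of_mem i ?_)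
            (sum_mem fun i _ => Submodule.mem_iSup_of_mem i ?_)
          · exact ⟨hπ.mem i _, zero_mem _⟩
          · exact ⟨zero_mem _, hρ.mem i _⟩
      d := A.str.d.prodMap B.str.d
      d_deg := fun i x hx => ⟨A.str.d_deg i _ hx.1, B.str.d_deg i _ hx.2⟩
      d_sq := LinearMap.ext fun x => Prod.ext (LinearMap.congr_fun A.str.d_sq x.1)
        (LinearMap.congr_fun B.str.d_sq x.2)
      bracket := LinearMap.mk₂ F
        (fun x y : A.L × B.L => (A.str.bracket x.1 y.1, B.str.bracket x.2 y.2))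
        (by intros; ext <;> simp) (by intros; ext <;> simp) (by intros; ext <;> simp)
        (by intros; ext <;> simp)
      bracket_deg := fun i j x hx y hy =>
        ⟨A.str.bracket_deg i j _ hx.1 _ hy.1, B.str.bracket_deg i j _ hx.2 _ hy.2⟩
      antisymm := fun i j x hx y hy => Prod.ext
        (by simpa using A.str.antisymm i j _ hx.1 _ hy.1)
        (by simpa using B.str.antisymm i j _ hx.2 _ hy.2)
      jacobi := fun i j x hx y hy z => Prod.ext
        (by simpa using A.str.jacobi i j _ hx.1 _ hy.1 z.1)
        (by simpa using B.str.jacobi i j _ hx.2 _ hy.2 z.2)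
      leibniz := fun i x hx y => Prod.ext
        (by simpa using A.str.leibniz i _ hx.1 y.1)
        (by simpa using B.str.leibniz i _ hx.2 y.2) }

/-- same graded space, zero differential and bracket -/
def abDGLA (A : DGLA F) : DGLA F where
  L := A.L
  str :=
    { grading := A.str.grading
      internal := A.str.internal
      d := 0
      d_deg := fun i x _ => zero_mem _
      d_sq := by simp
      bracket := 0
      bracket_deg := fun i j x _ y _ => zero_mem _
      antisymm := by intros; simp
      jacobi := by intros; simp
      leibniz := by intros; simp }

def DGLAHom.comp {A B C : DGLA F} (g : DGLAHom F B C) (f : DGLAHom F A B) : DGLAHom F A C where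
  f := g.f ∘ₗ f.f
  compat_d x := by simp [f.compat_d, g.compat_d]
  compat_br x y := by simp [f.compat_br, g.compat_br]
  compat_gr i x hx := g.compat_gr i _ (f.compat_gr i x hx)

/-- fibre product -/
def pb {A B C : DGLA F} (α : DGLAHom F A C) (β : DGLAHom F B C) : DGLA F :=
  subDGLA (prodDGLA A B)
    (LinearMap.eqLocus (α.f ∘ₗ LinearMap.fst F A.L B.L) (β.f ∘ₗ LinearMap.snd F A.L B.L))
    (by
      intro x hx
      change α.f x.1 = β.f x.2 at hx
      change α.f (A.str.d x.1) = β.f (B.str.d x.2)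
      rw [α.compat_d, β.compat_d, hx])
    (by
      intro x hx y hy
      change α.f x.1 = β.f x.2 at hx
      change α.f y.1 = β.f y.2 at hy
      change α.f (A.str.bracket x.1 y.1) = β.f (B.str.bracket x.2 y.2)
      rw [α.compat_br, β.compat_br, hx, hy])
    (by
      intro π hπ i x hx
      obtain ⟨ρ, hρ⟩ := exists_proj C.str.internal
      change α.f x.1 = β.f x.2 at hx
      have h1 := hπ.comm (prodDGLA A B).str.internal hρ
        (α.f ∘ₗ LinearMap.fst F A.L B.L) 0
        (fun i x hx => by rw [add_zero]; exact α.compat_gr i _ hx.1) i x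
      have h2 := hπ.comm (prodDGLA A B).str.internal hρ
        (β.f ∘ₗ LinearMap.snd F A.L B.L) 0
        (fun i x hx => by rw [add_zero]; exact β.compat_gr i _ hx.2) i x
      refine h1.trans (Eq.trans ?_ h2.symm)
      exact congrArg _ hx)

section Pb
variable {A B C E : DGLA F} (α : DGLAHom F A C) (β : DGLAHom F B C)

def pbFst : DGLAHom F (pb α β) A where
  f := LinearMap.fst F A.L B.L ∘ₗ Submodule.subtype _
  compat_d x := rfl
  compat_br x y := rfl
  compat_gr i x hx := hx.1

def pbSnd : DGLAHom F (pb α β) B where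
  f := LinearMap.snd F A.L B.L ∘ₗ Submodule.subtype _
  compat_d x := rfl
  compat_br x y := rfl
  compat_gr i x hx := hx.2

theorem pb_comm (x : (pb α β).L) : α.f ((pbFst α β).f x) = β.f ((pbSnd α β).f x) := x.2

theorem pb_exists (a : A.L) (b : B.L) (h : α.f a = β.f b) :
    ∃ x : (pb α β).L, (pbFst α β).f x = a ∧ (pbSnd α β).f x = b := ⟨⟨(a, b), h⟩, rfl, rfl⟩

theorem pb_ext (x y : (pb α β).L) (h1 : (pbFst α β).f x = (pbFst α β).f y)
    (h2 : (pbSnd α β).f x = (pbSnd α β).f y) : x = y := Subtype.ext (Prod.ext h1 h2)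

theorem dd (A : DGLA F) (x : A.L) : A.str.d (A.str.d x) = 0 := LinearMap.congr_fun A.str.d_sq x

theorem pbFst_qis (hβ : IsQuasiIso F β) (hs : Function.Surjective β.f) :
    IsQuasiIso F (pbFst α β) := by
  obtain ⟨hi, hsurj⟩ := hβ
  -- the kernel of `β` is acyclic
  have ker : ∀ k, B.str.d k = 0 → β.f k = 0 → ∃ l, B.str.d l = k ∧ β.f l = 0 := by
    intro k hk hk'
    obtain ⟨l, rfl⟩ := hi k hk ⟨0, by simp [hk']⟩
    obtain ⟨l', m, hl', hm⟩ := hsurj (β.f l) (by rw [← β.compat_d, hk'])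
    obtain ⟨m', rfl⟩ := hs m
    refine ⟨l - l' - B.str.d m', ?_, ?_⟩
    · simp [hl', dd]
    · simp [hm, β.compat_d]
  constructor
  · rintro x hx ⟨z, hz⟩
    obtain ⟨b0, hb0⟩ := hs (α.f z)
    have hx1 : B.str.d ((pbSnd α β).f x) = 0 := by rw [← (pbSnd α β).compat_d, hx, map_zero]
    obtain ⟨l, hl, hl'⟩ := ker ((pbSnd α β).f x - B.str.d b0)
      (by rw [map_sub, hx1, dd, sub_zero])
      (by rw [map_sub, ← pb_comm, hz, β.compat_d, hb0, α.compat_d, sub_self])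
    obtain ⟨w, hw1, hw2⟩ := pb_exists α β z (b0 + l) (by rw [map_add, hl', hb0, add_zero])
    refine ⟨w, pb_ext α β _ _ ?_ ?_⟩
    · rw [(pbFst α β).compat_d, hw1, hz]
    · rw [(pbSnd α β).compat_d, hw2, map_add, hl]; abel
  · intro a ha
    obtain ⟨b, m, hb, hm⟩ := hsurj (α.f a) (by rw [← α.compat_d, ha, map_zero])
    obtain ⟨m', rfl⟩ := hs m
    obtain ⟨w, hw1, hw2⟩ := pb_exists α β a (b + B.str.d m')
      (by rw [map_add, β.compat_d, hm])
    refine ⟨w, 0, pb_ext α β _ _ ?_ ?_, by simp [hw1]⟩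
    · rw [(pbFst α β).compat_d, hw1, ha, map_zero]
    · rw [(pbSnd α β).compat_d, hw2, map_add, hb, dd, map_zero, add_zero]

end Pb

/-- base case: a morphism to an abelian DGLA, injective on cohomology -/
theorem base_case {G A : DGLA F} (hA : ∀ x y, A.str.bracket x y = 0) (φ : DGLAHom F G A)
    (hinj : ∀ x : G.L, G.str.d x = 0 → (∃ z, φ.f x = A.str.d z) → ∃ w, x = G.str.d w) :
    HomotopyAbelian F G := by
  obtain ⟨π, hπ⟩ := exists_proj A.str.internal
  obtain ⟨ρ, hρ⟩ := exists_proj G.str.internal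
  have hdA := hπ.comm A.str.internal hπ A.str.d 1 A.str.d_deg
  have hdG := hρ.comm G.str.internal hρ G.str.d 1 G.str.d_deg
  have hφ : ∀ i x, φ.f (ρ i x) = π i (φ.f x) := by
    intro i x
    have := hρ.comm G.str.internal hπ φ.f 0 (by simpa using φ.compat_gr) i x
    simpa using this
  let B : Submodule F A.L := LinearMap.range A.str.d
  let S : Submodule F A.L := (LinearMap.ker G.str.d).map φ.f ⊔ B
  have hB : ∀ i, ∀ x ∈ B, π i x ∈ B := by
    rintro i _ ⟨x, rfl⟩
    refine ⟨π (i - 1) x, ?_⟩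
    rw [hdA, sub_add_cancel]
  have hS : ∀ i, ∀ x ∈ S, π i x ∈ S := by
    intro i x hx
    obtain ⟨_, ⟨y, hy, rfl⟩, b, hb, rfl⟩ := Submodule.mem_sup.1 hx
    rw [map_add]
    refine Submodule.add_mem_sup ⟨ρ i y, ?_, hφ i y⟩ (hB i b hb)
    have hy' : G.str.d y = 0 := hy
    change G.str.d (ρ i y) = 0
    rw [hdG, hy', map_zero]
  obtain ⟨p, p1, p2, p3⟩ := exists_graded_projection A.str.internal hπ S hS
  obtain ⟨q, q1, q2, q3⟩ := exists_graded_projection A.str.internal hπ B hB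
  have hBS : B ≤ S := le_sup_right
  let r : A.L →ₗ[F] A.L := p - q ∘ₗ p
  have rdef : ∀ x, r x = p x - q (p x) := fun x => rfl
  have rS : ∀ x, r x ∈ S := fun x => sub_mem (p1 x) (hBS (q1 _))
  have rr : ∀ x, r (r x) = r x := by
    intro x
    rw [rdef (r x), p2 _ (rS x), rdef, map_sub q, q2 (q (p x)) (q1 _)]
    abel
  have rB : ∀ x ∈ B, r x = 0 := by
    intro x hx
    rw [rdef, p2 x (hBS hx), q2 x hx, sub_self]
  have rgr : ∀ i, ∀ x ∈ A.str.grading i, r x ∈ A.str.grading i := fun i x hx =>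
    sub_mem (p3 i x hx) (q3 i _ (p3 i x hx))
  have rB' : ∀ x ∈ S, r x = 0 → x ∈ B := by
    intro x hx h
    rw [rdef, p2 x hx, sub_eq_zero] at h
    rw [h]; exact q1 x
  let T : DGLA F := subDGLA (abDGLA A) (LinearMap.range r)
    (fun x _ => zero_mem _) (fun x _ y _ => zero_mem _)
    (by
      rintro π' hπ' i _ ⟨x, rfl⟩
      refine ⟨π' i x, ?_⟩
      have := IsProj.comm A.str.internal hπ' hπ' r 0
        (fun i x hx => by rw [add_zero]; exact rgr i x hx) i x
      rw [add_zero] at this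
      exact this)
  have hTd : ∀ x, T.str.d x = 0 := fun x => rfl
  let ψ : DGLAHom F G T :=
    { f := r.rangeRestrict ∘ₗ φ.f
      compat_d := fun x => Subtype.ext (by
        change r (φ.f (G.str.d x)) = 0
        rw [φ.compat_d]
        exact rB _ ⟨_, rfl⟩)
      compat_br := fun x y => Subtype.ext (by
        change r (φ.f (G.str.bracket x y)) = 0
        rw [φ.compat_br, hA, map_zero])
      compat_gr := fun i x hx => rgr i _ (φ.compat_gr i x hx) }
  refine ⟨T, fun x y => rfl, Relation.EqvGen.rel _ _ ⟨ψ, ?_, ?_⟩⟩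
  · rintro x hx ⟨z, hz⟩
    have h0 : r (φ.f x) = 0 := congrArg Subtype.val hz
    obtain ⟨z, hz⟩ := rB' (φ.f x) (Submodule.mem_sup_left ⟨x, hx, rfl⟩) h0
    exact hinj x hx ⟨z, hz.symm⟩
  · rintro ⟨y, hy⟩ _
    obtain ⟨x, rfl⟩ := hy
    obtain ⟨_, ⟨g, hg, rfl⟩, b, hb, hgb⟩ := Submodule.mem_sup.1 (rS x)
    refine ⟨g, 0, hg, ?_⟩
    rw [map_zero, add_zero]
    refine Subtype.ext ?_
    change r x = r (φ.f g)
    rw [← rr x, ← hgb, map_add, rB b hb, add_zero]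

section Poly

open TensorProduct Polynomial

/-- The graded pieces of `F[t] ⊗ A`. -/
noncomputable def polyGr (A : DGLA F) (i : ℤ) : Submodule F (F[X] ⊗[F] A.L) :=
  Submodule.span F {t | ∃ p : F[X], ∃ x ∈ A.str.grading i, p ⊗ₜ[F] x = t}

theorem tmul_mem_polyGr (A : DGLA F) (i : ℤ) (p : F[X]) (x : A.L) (hx : x ∈ A.str.grading i) :
    p ⊗ₜ[F] x ∈ polyGr A i := Submodule.subset_span ⟨p, x, hx, rfl⟩

/-- To prove a submodule contains a graded piece, check pure tensors. -/
theorem polyGr_le (A : DGLA F) (i : ℤ) (S : Submodule F (F[X] ⊗[F] A.L))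
    (h : ∀ p : F[X], ∀ x ∈ A.str.grading i, p ⊗ₜ[F] x ∈ S) :
    ∀ t ∈ polyGr A i, t ∈ S := by
  have : polyGr A i ≤ S := by
    refine Submodule.span_le.2 ?_
    rintro _ ⟨p, x, hx, rfl⟩
    exact h p x hx
  exact this

/-- Two linear maps agreeing on pure homogeneous tensors agree on the graded piece. -/
theorem polyGr_eqOn {N : Type} [AddCommGroup N] [Module F N] (A : DGLA F) (i : ℤ)
    (f g : F[X] ⊗[F] A.L →ₗ[F] N)
    (h : ∀ p : F[X], ∀ x ∈ A.str.grading i, f (p ⊗ₜ[F] x) = g (p ⊗ₜ[F] x)) :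
    ∀ t ∈ polyGr A i, f t = g t :=
  polyGr_le A i (LinearMap.eqLocus f g) h

noncomputable def polyBr (A : DGLA F) :
    F[X] ⊗[F] A.L →ₗ[F] F[X] ⊗[F] A.L →ₗ[F] F[X] ⊗[F] A.L :=
  TensorProduct.map₂ (LinearMap.mul F F[X]) A.str.bracket

theorem polyBr_tmul (A : DGLA F) (p q : F[X]) (x y : A.L) :
    polyBr A (p ⊗ₜ[F] x) (q ⊗ₜ[F] y) = (p * q) ⊗ₜ[F] (A.str.bracket x y) := by
  simp [polyBr]

theorem zsmul_tmul' (A : DGLA F) (n : ℤ) (p : F[X]) (x : A.L) :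
    p ⊗ₜ[F] (n • x) = n • (p ⊗ₜ[F] x) :=
  map_zsmul (TensorProduct.mk F F[X] A.L p) n x

noncomputable def polyDGLA (A : DGLA F) : DGLA F where
  L := F[X] ⊗[F] A.L
  str :=
    { grading := polyGr A
      internal := by
        obtain ⟨π, hπ⟩ := exists_proj A.str.internal
        refine internal_of_proj (fun i => (π i).lTensor F[X]) ?_ ?_ ?_
        · intro i
          refine polyGr_eqOn A i _ LinearMap.id fun p x hx => ?_
          simp [hπ.same i x hx]
        · intro i j hij
          refine polyGr_eqOn A j _ 0 fun p x hx => ?_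
          simp [hπ.ne i j hij x hx]
        · intro t
          induction t using TensorProduct.induction_on with
          | zero => exact zero_mem _
          | add x y hx hy => exact add_mem hx hy
          | tmul p x =>
            obtain ⟨s, hs⟩ := hπ.sum x
            rw [hs, TensorProduct.tmul_sum]
            exact sum_mem fun i _ => Submodule.mem_iSup_of_mem i
              (tmul_mem_polyGr A i p _ (hπ.mem i x))
      d := A.str.d.lTensor F[X]
      d_deg := fun i => polyGr_le A i ((polyGr A (i + 1)).comap (A.str.d.lTensor F[X]))
        fun p x hx => tmul_mem_polyGr A (i + 1) p _ (A.str.d_deg i x hx)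
      d_sq := by
        rw [← LinearMap.lTensor_comp, A.str.d_sq, LinearMap.lTensor_zero]
      bracket := polyBr A
      bracket_deg := by
        intro i j t ht u hu
        refine polyGr_le A i ((polyGr A (i + j)).comap ((polyBr A).flip u)) ?_ t ht
        intro p x hx
        refine polyGr_le A j ((polyGr A (i + j)).comap (polyBr A (p ⊗ₜ[F] x))) ?_ u hu
        intro q y hy
        rw [Submodule.mem_comap, polyBr_tmul]
        exact tmul_mem_polyGr A _ _ _ (A.str.bracket_deg i j x hx y hy)
      antisymm := by
        intro i j t ht u hu
        refine polyGr_eqOn A i ((polyBr A).flip u)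
          (-(((i * j).negOnePow : ℤ) • polyBr A u)) ?_ t ht
        intro p x hx
        refine polyGr_eqOn A j (polyBr A (p ⊗ₜ[F] x))
          (-(((i * j).negOnePow : ℤ) • (polyBr A).flip (p ⊗ₜ[F] x))) ?_ u hu
        intro q y hy
        simp only [LinearMap.neg_apply, LinearMap.smul_apply, LinearMap.flip_apply, polyBr_tmul]
        rw [A.str.antisymm i j x hx y hy, TensorProduct.tmul_neg, zsmul_tmul', mul_comm p q]
      jacobi := by
        intro i j t ht u hu v
        refine polyGr_eqOn A i ((polyBr A).flip (polyBr A u v))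
          (((polyBr A).flip v) ∘ₗ ((polyBr A).flip u) +
            ((i * j).negOnePow : ℤ) • ((polyBr A u) ∘ₗ ((polyBr A).flip v))) ?_ t ht
        intro p x hx
        refine polyGr_eqOn A j ((polyBr A (p ⊗ₜ[F] x)) ∘ₗ (polyBr A).flip v)
          (((polyBr A).flip v) ∘ₗ (polyBr A (p ⊗ₜ[F] x)) +
            ((i * j).negOnePow : ℤ) • ((polyBr A).flip (polyBr A (p ⊗ₜ[F] x) v))) ?_ u hu
        intro q y hy
        simp only [LinearMap.add_apply, LinearMap.smul_apply, LinearMap.flip_apply,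
          LinearMap.comp_apply]
        induction v using TensorProduct.induction_on with
        | zero => simp
        | add v w hv hw =>
          simp only [map_add, LinearMap.add_apply, hv, hw, smul_add]
          abel
        | tmul r z =>
          simp only [polyBr_tmul]
          rw [A.str.jacobi i j x hx y hy z, TensorProduct.tmul_add, zsmul_tmul', mul_assoc,
            mul_left_comm q p r]
      leibniz := by
        intro i t ht u
        refine polyGr_eqOn A i ((A.str.d.lTensor F[X]) ∘ₗ ((polyBr A).flip u))
          (((polyBr A).flip u) ∘ₗ (A.str.d.lTensor F[X]) +
            (i.negOnePow : ℤ) • (polyBr A).flip (A.str.d.lTensor F[X] u)) ?_ t ht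
        intro p x hx
        simp only [LinearMap.add_apply, LinearMap.smul_apply, LinearMap.flip_apply,
          LinearMap.comp_apply]
        induction u using TensorProduct.induction_on with
        | zero => simp
        | add v w hv hw =>
          simp only [map_add, hv, hw, smul_add]
          abel
        | tmul r z =>
          simp only [polyBr_tmul, LinearMap.lTensor_tmul]
          rw [A.str.leibniz i x hx z, TensorProduct.tmul_add, zsmul_tmul'] }

theorem poly_eq {N : Type} [AddCommGroup N] [Module F N] (A : DGLA F)
    (f g : (polyDGLA A).L →ₗ[F] N)
    (h : ∀ (p : F[X]) (x : A.L), f (p ⊗ₜ[F] x) = g (p ⊗ₜ[F] x)) (t : (polyDGLA A).L) :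
    f t = g t :=
  LinearMap.congr_fun (TensorProduct.ext' (R := F) (M := F[X]) (N := A.L) h) t

/-- formal derivative in `t` -/
noncomputable def polyD (A : DGLA F) : (polyDGLA A).L →ₗ[F] (polyDGLA A).L :=
  (Polynomial.derivative : F[X] →ₗ[F] F[X]).rTensor A.L

theorem polyD_deg (A : DGLA F) (i : ℤ) : ∀ t ∈ (polyDGLA A).str.grading i,
    polyD A t ∈ (polyDGLA A).str.grading i :=
  polyGr_le A i ((polyGr A i).comap (polyD A)) fun p x hx =>
    tmul_mem_polyGr A i (derivative p) x hx

theorem polyD_d (A : DGLA F) (t : (polyDGLA A).L) :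
    polyD A ((polyDGLA A).str.d t) = (polyDGLA A).str.d (polyD A t) :=
  poly_eq A (polyD A ∘ₗ (polyDGLA A).str.d) ((polyDGLA A).str.d ∘ₗ polyD A) (fun _ _ => rfl) t

theorem polyD_br (A : DGLA F) (t u : (polyDGLA A).L) :
    polyD A ((polyDGLA A).str.bracket t u) =
      (polyDGLA A).str.bracket (polyD A t) u + (polyDGLA A).str.bracket t (polyD A u) := by
  refine poly_eq A ((polyD A) ∘ₗ (polyDGLA A).str.bracket.flip u)
    ((polyDGLA A).str.bracket.flip u ∘ₗ polyD A + (polyDGLA A).str.bracket.flip (polyD A u))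
    (fun p x => ?_) t
  refine poly_eq A ((polyD A) ∘ₗ (polyDGLA A).str.bracket (p ⊗ₜ[F] x))
    ((polyDGLA A).str.bracket (polyD A (p ⊗ₜ[F] x)) +
      (polyDGLA A).str.bracket (p ⊗ₜ[F] x) ∘ₗ polyD A)
    (fun q y => ?_) u
  change polyD A (polyBr A (p ⊗ₜ[F] x) (q ⊗ₜ[F] y)) =
    polyBr A ((derivative p) ⊗ₜ[F] x) (q ⊗ₜ[F] y) +
      polyBr A (p ⊗ₜ[F] x) ((derivative q) ⊗ₜ[F] y)
  rw [polyBr_tmul, polyBr_tmul, polyBr_tmul, ← TensorProduct.add_tmul]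
  change (derivative (p * q)) ⊗ₜ[F] _ = _
  rw [derivative_mul]
  rfl

/-- evaluation at `c` -/
noncomputable def polyEv (A : DGLA F) (c : F) : DGLAHom F (polyDGLA A) A where
  f := (TensorProduct.lid F A.L).toLinearMap ∘ₗ (Polynomial.leval c).rTensor A.L
  compat_d t := by
    refine poly_eq A (((TensorProduct.lid F A.L).toLinearMap ∘ₗ
        (Polynomial.leval c).rTensor A.L) ∘ₗ (polyDGLA A).str.d)
      (A.str.d ∘ₗ ((TensorProduct.lid F A.L).toLinearMap ∘ₗ
        (Polynomial.leval c).rTensor A.L)) (fun r z => ?_) t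
    change (r.eval c) • (A.str.d z) = A.str.d ((r.eval c) • z)
    rw [map_smul]
  compat_br t u := by
    have : (polyBr A).compr₂
        ((TensorProduct.lid F A.L).toLinearMap ∘ₗ (Polynomial.leval c).rTensor A.L) =
        A.str.bracket.compl₁₂
          ((TensorProduct.lid F A.L).toLinearMap ∘ₗ (Polynomial.leval c).rTensor A.L)
          ((TensorProduct.lid F A.L).toLinearMap ∘ₗ (Polynomial.leval c).rTensor A.L) := by
      refine TensorProduct.ext' fun p x => ?_
      refine TensorProduct.ext' fun q y => ?_
      simp only [LinearMap.compr₂_apply, LinearMap.compl₁₂_apply, polyBr_tmul]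
      simp only [LinearMap.comp_apply, LinearMap.rTensor_tmul, LinearEquiv.coe_coe,
        TensorProduct.lid_tmul, Polynomial.leval_apply, eval_mul, map_smul,
        LinearMap.smul_apply, mul_smul]
      rw [smul_comm]
    exact LinearMap.congr_fun (LinearMap.congr_fun this t) u
  compat_gr i := polyGr_le A i ((A.str.grading i).comap _) fun p x hx =>
    Submodule.smul_mem _ (p.eval c) hx

theorem polyEv_tmul (A : DGLA F) (c : F) (p : F[X]) (x : A.L) :
    (polyEv A c).f (p ⊗ₜ[F] x) = p.eval c • x := rfl

/-- constants -/
noncomputable def polyConst (A : DGLA F) : DGLAHom F A (polyDGLA A) where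
  f := TensorProduct.mk F F[X] A.L 1
  compat_d x := rfl
  compat_br x y := by
    change _ = polyBr A ((1 : F[X]) ⊗ₜ[F] x) ((1 : F[X]) ⊗ₜ[F] y)
    rw [polyBr_tmul, mul_one]; rfl
  compat_gr i x hx := tmul_mem_polyGr A i 1 x hx

theorem polyConst_D (A : DGLA F) (x : A.L) : polyD A ((polyConst A).f x) = 0 := by
  change (derivative (1 : F[X])) ⊗ₜ[F] x = 0
  simp

theorem polyEv_const (A : DGLA F) (c : F) (x : A.L) :
    (polyEv A c).f ((polyConst A).f x) = x := by
  change (polyEv A c).f ((1 : F[X]) ⊗ₜ[F] x) = x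
  rw [polyEv_tmul]; simp

/-- integration -/
noncomputable def integ : F[X] →ₗ[F] F[X] :=
  Polynomial.lsum fun n => (Polynomial.monomial (n + 1)) ∘ₗ (((n : F) + 1)⁻¹ • LinearMap.id)

theorem integ_monomial (n : ℕ) (a : F) :
    integ (monomial n a) = monomial (n + 1) (((n : F) + 1)⁻¹ * a) := by
  simp [integ, Polynomial.lsum_apply, Polynomial.sum_monomial_index]

theorem D_integ [CharZero F] (p : F[X]) : derivative (integ p) = p := by
  induction p using Polynomial.induction_on' with
  | add p q hp hq => simp [hp, hq]
  | monomial n a =>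
    have : (n : F) + 1 ≠ 0 := by exact_mod_cast Nat.succ_ne_zero n
    rw [integ_monomial, derivative_monomial]
    simp only [Nat.add_sub_cancel, Nat.cast_add, Nat.cast_one]
    congr 1
    field_simp

theorem integ_D [CharZero F] (p : F[X]) : integ (derivative p) = p - (p.eval 0) • 1 := by
  induction p using Polynomial.induction_on' with
  | add p q hp hq => simp only [map_add, hp, hq, eval_add, add_smul]; ring
  | monomial n a =>
    cases n with
    | zero => simp [Polynomial.smul_eq_C_mul]
    | succ n =>
      have : (n : F) + 1 ≠ 0 := by exact_mod_cast Nat.succ_ne_zero n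
      rw [derivative_monomial, integ_monomial]
      simp only [Nat.add_sub_cancel, Nat.cast_add, Nat.cast_one, eval_monomial]
      simp
      congr 1
      field_simp

theorem exists_integ [CharZero F] (A : DGLA F) : ∃ I : (polyDGLA A).L →ₗ[F] (polyDGLA A).L,
    (∀ t, polyD A (I t) = t) ∧ (∀ t, I (polyD A t) = t - (polyConst A).f ((polyEv A 0).f t)) ∧
    (∀ t, I ((polyDGLA A).str.d t) = (polyDGLA A).str.d (I t)) := by
  let I : (polyDGLA A).L →ₗ[F] (polyDGLA A).L := integ.rTensor A.L
  refine ⟨I, ?_, ?_, ?_⟩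
  · refine poly_eq A (polyD A ∘ₗ I) LinearMap.id fun r z => ?_
    change (derivative (integ r)) ⊗ₜ[F] z = r ⊗ₜ[F] z
    rw [D_integ]
  · refine poly_eq A (I ∘ₗ polyD A)
      (LinearMap.id - (polyConst A).f ∘ₗ (polyEv A 0).f) fun r z => ?_
    change (integ (derivative r)) ⊗ₜ[F] z = r ⊗ₜ[F] z - (1 : F[X]) ⊗ₜ[F] (r.eval 0 • z)
    rw [integ_D, TensorProduct.sub_tmul, TensorProduct.smul_tmul]
  · exact poly_eq A (I ∘ₗ (polyDGLA A).str.d) ((polyDGLA A).str.d ∘ₗ I) fun r z => rfl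

end Poly

section Cyl

theorem exists_sign (M : DGLA F) : ∃ σ : M.L →ₗ[F] M.L,
    ∀ i, ∀ x ∈ M.str.grading i, σ x = (i.negOnePow : ℤ) • x := by
  obtain ⟨σ, h⟩ := exists_extend_gr M.str.internal
    (fun i => (i.negOnePow : ℤ) • (LinearMap.id : M.L →ₗ[F] M.L))
  exact ⟨σ, fun i x hx => by rw [h i x hx]; rfl⟩

noncomputable def sgn (M : DGLA F) : M.L →ₗ[F] M.L := (exists_sign M).choose

theorem sgn_apply (M : DGLA F) (i : ℤ) (x : M.L) (hx : x ∈ M.str.grading i) :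
    sgn M x = (i.negOnePow : ℤ) • x := (exists_sign M).choose_spec i x hx

theorem negOnePow_cases (i : ℤ) : (i.negOnePow : ℤ) = 1 ∨ (i.negOnePow : ℤ) = -1 := by
  rcases Int.units_eq_one_or i.negOnePow with h | h <;> simp [h]

theorem negOnePow_pred (i : ℤ) : ((i - 1).negOnePow : ℤ) = -(i.negOnePow : ℤ) := by
  simp [Int.negOnePow_sub]

theorem negOnePow_succ' (i : ℤ) : ((i + 1).negOnePow : ℤ) = -(i.negOnePow : ℤ) := by
  simp [Int.negOnePow_succ]

theorem negOnePow_add' (i j : ℤ) :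
    ((i + j).negOnePow : ℤ) = (i.negOnePow : ℤ) * (j.negOnePow : ℤ) := by
  simp [Int.negOnePow_add]

theorem negOnePow_pred_mul (i j : ℤ) :
    (((i - 1) * j).negOnePow : ℤ) = ((i * j).negOnePow : ℤ) * (j.negOnePow : ℤ) := by
  rw [sub_mul, one_mul]; simp [Int.negOnePow_sub]

theorem negOnePow_mul_pred (i j : ℤ) :
    ((i * (j - 1)).negOnePow : ℤ) = ((i * j).negOnePow : ℤ) * (i.negOnePow : ℤ) := by
  rw [mul_comm, negOnePow_pred_mul, mul_comm j i]

/-- `M ⊕ ε M` for a DGLA `M` with a degree zero derivation `D` commuting with `d`;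
`ε` has degree one, `d ε = 0`, and the differential is `d + ε D`. -/
noncomputable def cyl (M : DGLA F) (D : M.L →ₗ[F] M.L)
    (D_deg : ∀ i, ∀ x ∈ M.str.grading i, D x ∈ M.str.grading i)
    (D_d : ∀ x, D (M.str.d x) = M.str.d (D x))
    (D_br : ∀ x y, D (M.str.bracket x y) = M.str.bracket (D x) y + M.str.bracket x (D y)) :
    DGLA F where
  L := M.L × M.L
  str :=
    { grading := fun i => (M.str.grading i).prod (M.str.grading (i - 1))
      internal := by
        obtain ⟨π, hπ⟩ := exists_proj M.str.internal
        refine internal_of_proj (fun i => (π i).prodMap (π (i - 1))) ?_ ?_ ?_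
        · intro i x hx
          exact Prod.ext (hπ.same i _ hx.1) (hπ.same (i - 1) _ hx.2)
        · intro i j hij x hx
          exact Prod.ext (hπ.ne i j hij _ hx.1)
            (hπ.ne (i - 1) (j - 1) (fun h => hij (by linarith)) _ hx.2)
        · intro x
          obtain ⟨s, hs⟩ := hπ.sum x.1
          obtain ⟨t, ht⟩ := hπ.sum x.2
          have : x = ∑ i ∈ s, LinearMap.inl F M.L M.L (π i x.1)
              + ∑ i ∈ t, LinearMap.inr F M.L M.L (π i x.2) := by
            rw [← map_sum, ← map_sum, ← hs, ← ht]
            simp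
          rw [this]
          refine add_mem (sum_mem fun i _ => Submodule.mem_iSup_of_mem i ?_)
            (sum_mem fun i _ => Submodule.mem_iSup_of_mem (i + 1) ?_)
          · exact ⟨hπ.mem i _, zero_mem _⟩
          · refine ⟨zero_mem _, ?_⟩
            rw [add_sub_cancel_right]
            exact hπ.mem i _
      d := (M.str.d ∘ₗ LinearMap.fst F M.L M.L).prod
        (D ∘ₗ LinearMap.fst F M.L M.L - M.str.d ∘ₗ LinearMap.snd F M.L M.L)
      d_deg := fun i x hx => by
        refine ⟨M.str.d_deg i _ hx.1, ?_⟩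
        have h2 := M.str.d_deg (i - 1) _ hx.2
        rw [sub_add_cancel] at h2
        rw [add_sub_cancel_right]
        exact sub_mem (D_deg i _ hx.1) h2
      d_sq := LinearMap.ext fun x => Prod.ext (dd M x.1) (by
        change D (M.str.d x.1) - M.str.d (D x.1 - M.str.d x.2) = 0
        rw [map_sub, dd, D_d]; simp)
      bracket := LinearMap.mk₂ F
        (fun x y : M.L × M.L => (M.str.bracket x.1 y.1,
          M.str.bracket x.2 y.1 + M.str.bracket (sgn M x.1) y.2))
        (by intros; ext <;> simp; abel) (by intros; ext <;> simp)
        (by intros; ext <;> simp; abel) (by intros; ext <;> simp)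
      bracket_deg := fun i j x hx y hy => by
        refine ⟨M.str.bracket_deg i j _ hx.1 _ hy.1, ?_⟩
        change M.str.bracket x.2 y.1 + M.str.bracket (sgn M x.1) y.2 ∈ _
        have h1 := M.str.bracket_deg (i - 1) j _ hx.2 _ hy.1
        have h2 := M.str.bracket_deg i (j - 1) _ hx.1 _ hy.2
        rw [sgn_apply M i _ hx.1, map_zsmul, LinearMap.smul_apply]
        rw [show i - 1 + j = i + j - 1 by ring] at h1
        rw [show i + (j - 1) = i + j - 1 by ring] at h2
        exact add_mem h1 (zsmul_mem h2 _)
      antisymm := fun i j x hx y hy => Prod.ext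
        (M.str.antisymm i j _ hx.1 _ hy.1) (by
        change M.str.bracket x.2 y.1 + M.str.bracket (sgn M x.1) y.2 =
          -(((i * j).negOnePow : ℤ) • (M.str.bracket y.2 x.1 + M.str.bracket (sgn M y.1) x.2))
        rw [sgn_apply M i _ hx.1, sgn_apply M j _ hy.1]
        rw [M.str.antisymm (i - 1) j _ hx.2 _ hy.1]
        simp only [map_zsmul, LinearMap.smul_apply]
        rw [M.str.antisymm i (j - 1) _ hx.1 _ hy.2, negOnePow_pred_mul, negOnePow_mul_pred]
        rcases negOnePow_cases i with h1 | h1 <;> rcases negOnePow_cases j with h2 | h2 <;>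
          rcases negOnePow_cases (i * j) with h3 | h3 <;> rw [h1, h2, h3] <;> module)
      jacobi := fun i j x hx y hy z => Prod.ext
        (M.str.jacobi i j _ hx.1 _ hy.1 z.1) (by
        change M.str.bracket x.2 (M.str.bracket y.1 z.1) + M.str.bracket (sgn M x.1)
            (M.str.bracket y.2 z.1 + M.str.bracket (sgn M y.1) z.2) =
          (M.str.bracket (M.str.bracket x.2 y.1 + M.str.bracket (sgn M x.1) y.2) z.1
            + M.str.bracket (sgn M (M.str.bracket x.1 y.1)) z.2) +
          ((i * j).negOnePow : ℤ) • (M.str.bracket y.2 (M.str.bracket x.1 z.1) +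
            M.str.bracket (sgn M y.1)
              (M.str.bracket x.2 z.1 + M.str.bracket (sgn M x.1) z.2))
        rw [sgn_apply M i _ hx.1, sgn_apply M j _ hy.1,
          sgn_apply M (i + j) _ (M.str.bracket_deg i j _ hx.1 _ hy.1)]
        simp only [map_zsmul, map_add, LinearMap.smul_apply, LinearMap.add_apply]
        rw [M.str.jacobi (i - 1) j _ hx.2 _ hy.1, M.str.jacobi i (j - 1) _ hx.1 _ hy.2,
          M.str.jacobi i j _ hx.1 _ hy.1, negOnePow_pred_mul, negOnePow_mul_pred, negOnePow_add']
        rcases negOnePow_cases i with h1 | h1 <;> rcases negOnePow_cases j with h2 | h2 <;>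
          rcases negOnePow_cases (i * j) with h3 | h3 <;> rw [h1, h2, h3] <;> module)
      leibniz := fun i x hx y => Prod.ext
        (M.str.leibniz i _ hx.1 y.1) (by
        change D (M.str.bracket x.1 y.1) - M.str.d (M.str.bracket x.2 y.1 +
            M.str.bracket (sgn M x.1) y.2) =
          (M.str.bracket (D x.1 - M.str.d x.2) y.1 + M.str.bracket (sgn M (M.str.d x.1)) y.2) +
          (i.negOnePow : ℤ) • (M.str.bracket x.2 (M.str.d y.1) +
            M.str.bracket (sgn M x.1) (D y.1 - M.str.d y.2))
        rw [sgn_apply M i _ hx.1, sgn_apply M (i + 1) _ (M.str.d_deg i _ hx.1), D_br]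
        simp only [map_zsmul, map_add, map_sub, LinearMap.smul_apply, LinearMap.sub_apply]
        rw [M.str.leibniz (i - 1) _ hx.2, M.str.leibniz i _ hx.1, negOnePow_pred,
          negOnePow_succ']
        rcases negOnePow_cases i with h1 | h1 <;> rw [h1] <;> module) }

/-- the path object `A[t, dt]` -/
noncomputable def path (A : DGLA F) : DGLA F :=
  cyl (polyDGLA A) (polyD A) (polyD_deg A) (polyD_d A) (polyD_br A)

noncomputable def pathEv (A : DGLA F) (c : F) : DGLAHom F (path A) A where
  f := (polyEv A c).f ∘ₗ LinearMap.fst F (polyDGLA A).L (polyDGLA A).L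
  compat_d x := (polyEv A c).compat_d x.1
  compat_br x y := (polyEv A c).compat_br x.1 y.1
  compat_gr i x hx := (polyEv A c).compat_gr i x.1 hx.1

noncomputable def pathConst (A : DGLA F) : DGLAHom F A (path A) where
  f := LinearMap.inl F (polyDGLA A).L (polyDGLA A).L ∘ₗ (polyConst A).f
  compat_d x := Prod.ext ((polyConst A).compat_d x) (by
    change 0 = polyD A ((polyConst A).f x) - (polyDGLA A).str.d 0
    rw [polyConst_D, map_zero, sub_zero])
  compat_br x y := Prod.ext ((polyConst A).compat_br x y) (by
    change 0 = (polyDGLA A).str.bracket 0 _ + (polyDGLA A).str.bracket _ 0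
    simp)
  compat_gr i x hx := ⟨(polyConst A).compat_gr i x hx, zero_mem _⟩

theorem pathEv_const (A : DGLA F) (c : F) (x : A.L) :
    (pathEv A c).f ((pathConst A).f x) = x := polyEv_const A c x

theorem pathEv_zero_qis [CharZero F] (A : DGLA F) : IsQuasiIso F (pathEv A 0) := by
  constructor
  · rintro ⟨p, q⟩ hx ⟨z, hz⟩
    have h1 : (polyDGLA A).str.d p = 0 := congrArg Prod.fst hx
    have h2 : polyD A p - (polyDGLA A).str.d q = 0 := congrArg Prod.snd hx
    have h3 : (polyEv A 0).f p = A.str.d z := hz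
    obtain ⟨I, hI1, hI2, hI3⟩ := exists_integ A
    refine ⟨(I q + (polyConst A).f z, 0), Prod.ext ?_ ?_⟩
    · change p = (polyDGLA A).str.d (I q + (polyConst A).f z)
      rw [map_add, ← hI3, ← sub_eq_zero.1 h2, hI2, h3, (polyConst A).compat_d]
      abel
    · change q = polyD A (I q + (polyConst A).f z) - (polyDGLA A).str.d 0
      rw [map_add, hI1, polyConst_D, map_zero, add_zero, sub_zero]
  · intro y hy
    refine ⟨(pathConst A).f y, 0, ?_, ?_⟩
    · rw [← (pathConst A).compat_d, hy, map_zero]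
    · rw [pathEv_const, map_zero, add_zero]

open Polynomial TensorProduct in
theorem exists_path (A : DGLA F) (x : A.L) :
    ∃ p, (pathEv A 0).f p = 0 ∧ (pathEv A 1).f p = x := by
  refine ⟨((X : F[X]) ⊗ₜ[F] x, 0), ?_, ?_⟩
  · change (X : F[X]).eval 0 • x = 0
    simp
  · change (X : F[X]).eval 1 • x = x
    simp

end Cyl

/-- every quasi-isomorphism is replaced by a surjective one -/
theorem dgla_factorization [CharZero F] {A B : DGLA F} (ψ : DGLAHom F A B) (hψ : IsQuasiIso F ψ) :
    ∃ (E : DGLA F) (r : DGLAHom F E A) (e : DGLAHom F E B),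
      IsQuasiIso F r ∧ IsQuasiIso F e ∧ Function.Surjective e.f := by
  let ev := pathEv B (0 : F)
  have hsurj : Function.Surjective ev.f := fun x => ⟨(pathConst B).f x, pathEv_const B 0 x⟩
  have hr := pbFst_qis ψ ev (pathEv_zero_qis B) hsurj
  let r := pbFst ψ ev
  let e := (pathEv B 1).comp (pbSnd ψ ev)
  have hs : ∀ a, ∃ x, r.f x = a ∧ (pbSnd ψ ev).f x = (pathConst B).f (ψ.f a) := fun a =>
    pb_exists ψ ev a ((pathConst B).f (ψ.f a)) (pathEv_const B 0 _).symm
  have hsd : ∀ a x, r.f x = a → (pbSnd ψ ev).f x = (pathConst B).f (ψ.f a) →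
      ∀ a' x', r.f x' = a' → (pbSnd ψ ev).f x' = (pathConst B).f (ψ.f a') →
      A.str.d a = a' → (pb ψ ev).str.d x = x' := by
    intro a x h1 h2 a' x' h1' h2' h
    refine pb_ext ψ ev _ _ ?_ ?_
    · rw [(pbFst ψ ev).compat_d]
      change A.str.d (r.f x) = r.f x'
      rw [h1, h1', h]
    · rw [(pbSnd ψ ev).compat_d, h2, h2', ← h, ψ.compat_d, (pathConst B).compat_d]
  have hes : ∀ a x, (pbSnd ψ ev).f x = (pathConst B).f (ψ.f a) → e.f x = ψ.f a := by
    intro a x h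
    change (pathEv B 1).f ((pbSnd ψ ev).f x) = _
    rw [h, pathEv_const]
  refine ⟨pb ψ ev, r, e, hr, ⟨?_, ?_⟩, ?_⟩
  · rintro x hx ⟨z, hz⟩
    obtain ⟨s, hs1, hs2⟩ := hs (r.f x)
    have hra : A.str.d (r.f x) = 0 := by rw [← r.compat_d, hx, map_zero]
    have hsc : (pb ψ ev).str.d s = 0 :=
      hsd _ s hs1 hs2 0 0 (map_zero _) (by simp) hra
    obtain ⟨w, hw⟩ := hr.1 (x - s) (by rw [map_sub, hx, hsc, sub_zero])
      ⟨0, by rw [map_zero, map_sub, sub_eq_zero]; exact hs1.symm⟩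
    obtain ⟨v, hv⟩ := hψ.1 (r.f x) hra ⟨z - e.f w, by
      rw [map_sub, ← hz, ← e.compat_d, ← hw, map_sub, hes _ s hs2]; abel⟩
    obtain ⟨sv, hsv1, hsv2⟩ := hs v
    have := hsd v sv hsv1 hsv2 _ s hs1 hs2 hv.symm
    refine ⟨w + sv, ?_⟩
    rw [map_add, this, ← hw]; abel
  · intro y hy
    obtain ⟨a, z, ha, haz⟩ := hψ.2 y hy
    obtain ⟨s, hs1, hs2⟩ := hs a
    refine ⟨s, z, hsd _ s hs1 hs2 0 0 (map_zero _) (by simp) ha, ?_⟩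
    rw [hes a s hs2, haz]
  · intro y
    obtain ⟨p, hp0, hp1⟩ := exists_path B y
    obtain ⟨x, _, hx⟩ := pb_exists ψ ev 0 p (by rw [map_zero]; exact hp0.symm)
    refine ⟨x, ?_⟩
    change (pathEv B 1).f ((pbSnd ψ ev).f x) = _
    rw [hx, hp1]

def Good (H : DGLA F) : Prop :=
  ∀ (G : DGLA F) (φ : DGLAHom F G H),
    (∀ x : G.L, G.str.d x = 0 → (∃ z, φ.f x = H.str.d z) → ∃ w, x = G.str.d w) →
    HomotopyAbelian F G

theorem good_iff [CharZero F] {A B : DGLA F} (ψ : DGLAHom F A B) (hψ : IsQuasiIso F ψ) :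
    Good A ↔ Good B := by
  constructor
  · intro hA G φ hφ
    obtain ⟨E, r, e, hr, he, hs⟩ := dgla_factorization ψ hψ
    have hq := pbFst_qis φ e he hs
    have := hA (pb φ e) (r.comp (pbSnd φ e)) (by
      rintro x hx ⟨z, hz⟩
      obtain ⟨w, hw⟩ := hr.1 ((pbSnd φ e).f x)
        (by rw [← (pbSnd φ e).compat_d, hx, map_zero]) ⟨z, hz⟩
      obtain ⟨v, hv⟩ := hφ ((pbFst φ e).f x)
        (by rw [← (pbFst φ e).compat_d, hx, map_zero])
        ⟨e.f w, by rw [pb_comm, hw, e.compat_d]⟩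
      exact hq.1 x hx ⟨v, hv⟩)
    obtain ⟨T, hT, hz⟩ := this
    exact ⟨T, hT, Relation.EqvGen.trans _ _ _
      (Relation.EqvGen.symm _ _ (Relation.EqvGen.rel _ _ ⟨_, hq⟩)) hz⟩
  · intro hB G φ hφ
    refine hB G (ψ.comp φ) ?_
    rintro x hx ⟨z, hz⟩
    exact hφ x hx (hψ.1 (φ.f x) (by rw [← φ.compat_d, hx, map_zero]) ⟨z, hz⟩)

theorem good_zigzag [CharZero F] {A B : DGLA F} (h : ZigZag F A B) : Good A ↔ Good B := by
  induction h with
  | rel x y h => obtain ⟨ψ, hψ⟩ := h; exact good_iff ψ hψ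
  | refl x => rfl
  | symm x y _ ih => exact ih.symm
  | trans x y z _ _ ih1 ih2 => exact ih1.trans ih2

end Helpers

/-- If `φ : g → h` is a DGLA morphism injective on cohomology and `h` is
homotopy abelian, then `g` is homotopy abelian.  (Injectivity of `H*(φ)` is stated
elementwise: a cocycle of `g` whose image is a coboundary is a coboundary.) -/
theorem homotopy_abelian_of_injective_into_homotopy_abelian
    {G H : DGLA K} (φ : DGLAHom K G H)
    (hinj : ∀ x : G.L, G.str.d x = 0 → (∃ z, φ.f x = H.str.d z) → ∃ w, x = G.str.d w)
    (hH : HomotopyAbelian K H) :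
    HomotopyAbelian K G := by
  obtain ⟨T, hT, hz⟩ := hH
  exact (good_zigzag hz).2 (fun G φ hφ => base_case hT φ hφ) G φ hinj
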